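/- Let T be the d-regular tree with d ≥ 3 and A = Aut(T). There exists a finitely generated subgroup Γ ≤ A such that Γ is a free group, Γ is dense in A (in the topology of pointwise convergence), and Γ acts almost freely on T. -/

import Mathlib

namespace TreePaper

variable {V : Type*}

/-- The automorphism group of a graph, as a subgroup of the permutation group of vertices. -/
def graphAut (G : SimpleGraph V) : Subgroup (Equiv.Perm V) where
  carrier := {f | ∀ u v, G.Adj (f u) (f v) ↔ G.Adj u v}
  one_mem' := fun _ _ => Iff.rfl
  mul_mem' := by
    intro f g hf hg u v
    exact (hf (g u) (g v)).trans (hg u v)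
  inv_mem' := by
    intro f hf u v
    simpa using (hf (f⁻¹ u) (f⁻¹ v)).symm

/-- `G` is a `d`-regular tree: connected, acyclic, every vertex of degree `d`. -/
def IsRegularTree (G : SimpleGraph V) (d : ℕ) : Prop :=
  G.Connected ∧ G.IsAcyclic ∧ ∀ v : V, (G.neighborSet v).ncard = d

/-- A subgroup of `Aut T` acts almost freely if every nontrivial element has
finitely many fixed vertices. -/
def ActsAlmostFreely (G : SimpleGraph V) (Γ : Subgroup ↥(graphAut G)) : Prop :=
  ∀ γ ∈ Γ, γ ≠ 1 → {v : V | (γ : Equiv.Perm V) v = v}.Finite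

/-- The topology of pointwise convergence on vertices on `Aut T`: the topology induced by the
inclusion into the product space `V → V`, where `V` is discrete. -/
def pointwiseTopology (G : SimpleGraph V) : TopologicalSpace ↥(graphAut G) :=
  TopologicalSpace.induced (fun a : ↥(graphAut G) => ((a : Equiv.Perm V) : V → V))
    (@Pi.topologicalSpace V (fun _ => V) fun _ => ⊥)

namespace Mdl

abbrev X (k : ℕ) := Bool × List (Fin (k+2))

variable {k : ℕ}

def cons (c : Fin (k+2)) (x : X k) : X k := (x.1, c :: x.2)
def ext (v : List (Fin (k+2))) (x : X k) : X k := (x.1, v ++ x.2)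
def len (x : X k) : ℕ := x.2.length
def par : X k → X k
  | (e, []) => (!e, [])
  | (e, _ :: p) => (e, p)
def madj (x y : X k) : Prop := par x = y ∨ par y = x

@[simp] lemma par_cons (c : Fin (k+2)) (x : X k) : par (cons c x) = x := rfl
@[simp] lemma len_cons (c : Fin (k+2)) (x : X k) : len (cons c x) = len x + 1 := rfl
@[simp] lemma len_ext (v : List (Fin (k+2))) (x : X k) : len (ext v x) = v.length + len x := by
  simp [len, ext]
@[simp] lemma ext_nil (x : X k) : ext [] x = x := rfl
@[simp] lemma ext_cons (c) (v : List (Fin (k+2))) (x : X k) :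
    ext (c :: v) x = cons c (ext v x) := rfl
lemma ext_append (u v : List (Fin (k+2))) (x : X k) : ext (u ++ v) x = ext u (ext v x) := by
  simp [ext]
lemma cons_inj {c c' : Fin (k+2)} {x y : X k} : cons c x = cons c' y ↔ c = c' ∧ x = y := by
  obtain ⟨a, p⟩ := x; obtain ⟨b, q⟩ := y
  simp [cons]; tauto
lemma ext_inj {u v : List (Fin (k+2))} {x y : X k} (hl : u.length = v.length)
    (h : ext u x = ext v y) : u = v ∧ x = y := by
  obtain ⟨a, p⟩ := x; obtain ⟨b, q⟩ := y
  simp only [ext, Prod.mk.injEq] at h ⊢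
  have := List.append_inj h.2 hl
  tauto
lemma finite_len (n : ℕ) : {x : X k | len x ≤ n}.Finite := by
  have : {x : X k | len x ≤ n} ⊆ (Set.univ : Set Bool) ×ˢ {l : List (Fin (k+2)) | l.length ≤ n} := by
    intro x hx; exact ⟨trivial, hx⟩
  exact (Set.Finite.prod Set.finite_univ (List.finite_length_le _ n)).subset this
lemma exists_ext (y : X k) (n : ℕ) (h : n ≤ len y) : ∃ v x, y = ext v x ∧ len x = n := by
  refine ⟨y.2.take (len y - n), (y.1, y.2.drop (len y - n)), ?_, ?_⟩
  · simp [ext]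
  · simp only [len, List.length_drop] at *; omega

/-- twisting -/
def tl (φ : X k → Equiv.Perm (Fin (k+2))) (e : Bool) : List (Fin (k+2)) → List (Fin (k+2))
  | [] => []
  | c :: p => φ (e, p) c :: tl φ e p
def itl (φ : X k → Equiv.Perm (Fin (k+2))) (e : Bool) : List (Fin (k+2)) → List (Fin (k+2))
  | [] => []
  | c :: p => (φ (e, itl φ e p))⁻¹ c :: itl φ e p

lemma itl_tl (φ : X k → Equiv.Perm (Fin (k+2))) (e : Bool) (l) : itl φ e (tl φ e l) = l := by
  induction l with
  | nil => rfl
  | cons c p ih => simp [tl, itl, ih]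
lemma tl_itl (φ : X k → Equiv.Perm (Fin (k+2))) (e : Bool) (l) : tl φ e (itl φ e l) = l := by
  induction l with
  | nil => rfl
  | cons c p ih => simp [tl, itl, ih]

def tw (φ : X k → Equiv.Perm (Fin (k+2))) : Equiv.Perm (X k) where
  toFun x := (x.1, tl φ x.1 x.2)
  invFun x := (x.1, itl φ x.1 x.2)
  left_inv x := by simp [itl_tl]
  right_inv x := by simp [tl_itl]

lemma tw_cons (φ : X k → Equiv.Perm (Fin (k+2))) (c x) :
    tw φ (cons c x) = cons (φ x c) (tw φ x) := rfl
lemma len_tw (φ : X k → Equiv.Perm (Fin (k+2))) (x) : len (tw φ x) = len x := by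
  obtain ⟨e, p⟩ := x
  induction p with
  | nil => rfl
  | cons c p ih => exact congrArg (· + 1) ih
lemma par_tw (φ : X k → Equiv.Perm (Fin (k+2))) (x) : par (tw φ x) = tw φ (par x) := by
  obtain ⟨e, p⟩ := x
  cases p with
  | nil => rfl
  | cons c p => rfl
lemma madj_tw (φ : X k → Equiv.Perm (Fin (k+2))) (x y) : madj (tw φ x) (tw φ y) ↔ madj x y := by
  simp [madj, par_tw]

def flip : Equiv.Perm (X k) where
  toFun x := (!x.1, x.2)
  invFun x := (!x.1, x.2)
  left_inv x := by simp
  right_inv x := by simp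

lemma par_flip (x : X k) : par (flip x) = flip (par x) := by
  obtain ⟨e, p⟩ := x
  cases p <;> simp [par, flip]
lemma madj_flip (x y : X k) : madj (flip x) (flip y) ↔ madj x y := by
  simp [madj, par_flip]

def exf : X k → X k
  | (true, p) => (false, p ++ [0])
  | (false, p) => if p.getLast? = some 0 then (true, p.dropLast) else (false, p)

lemma exf_invol (x : X k) : exf (exf x) = x := by
  obtain ⟨e, p⟩ := x
  cases e
  · by_cases h : p.getLast? = some 0
    · have : exf (false, p) = (true, p.dropLast) := by simp [exf, h]
      rw [this]
      simp only [exf, Prod.mk.injEq, true_and]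
      exact List.dropLast_append_getLast? 0 h
    · have : exf (false, p) = (false, p) := by simp [exf, h]
      rw [this, this]
  · simp [exf]

def ex : Equiv.Perm (X k) := ⟨exf, exf, exf_invol, exf_invol⟩

lemma ex_cons (c) (x : X k) (h : 1 ≤ len x) : ex (cons c x) = cons c (ex x) := by
  obtain ⟨e, p⟩ := x
  cases e
  · cases p with
    | nil => simp [len] at h
    | cons a p =>
      change exf (false, c :: a :: p) = cons c (exf (false, a :: p))
      simp only [exf, List.getLast?_cons_cons]
      split_ifs <;> rfl
  · rfl

lemma ex_apply (x : X k) : ex x = exf x := rfl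
lemma ex_nil_false : ex ((false, []) : X k) = (false, []) := by
  simp [ex_apply, exf]
lemma ex_nil_true : ex ((true, []) : X k) = (false, [0]) := by
  simp [ex_apply, exf]
lemma ex_one (c) : ex ((false, [c]) : X k) = if c = 0 then (true, []) else (false, [c]) := by
  simp [ex_apply, exf]
lemma ex_one_true (c) : ex ((true, [c]) : X k) = (false, [c, 0]) := by
  simp [ex_apply, exf]

lemma madj_ex_par (x : X k) : madj (ex x) (ex (par x)) := by
  obtain ⟨e, p⟩ := x
  match p with
  | [] => cases e <;> simp [par, ex_nil_false, ex_nil_true, madj]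
  | [c] => 
    cases e
    · simp only [par, ex_nil_false, ex_one]
      split_ifs <;> simp [madj, par]
    · simp [par, ex_nil_true, ex_one_true, madj]
  | c :: a :: p => 
    left
    have : ((e, c :: a :: p) : X k) = cons c (e, a :: p) := rfl
    rw [this, ex_cons _ _ (by simp [len])]
    rfl

lemma madj_comm {x y : X k} : madj x y ↔ madj y x := or_comm
lemma madj_ex_of (x y : X k) (h : madj x y) : madj (ex x) (ex y) := by
  rcases h with rfl | rfl
  · exact madj_ex_par x
  · exact madj_comm.1 (madj_ex_par y)
lemma ex_ex (x : X k) : ex (ex x) = x := exf_invol x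
lemma madj_ex (x y : X k) : madj (ex x) (ex y) ↔ madj x y :=
  ⟨fun h => by simpa [ex_ex] using madj_ex_of _ _ h, madj_ex_of x y⟩

lemma len_ex (x : X k) : len (ex x) ≤ len x + 1 := by
  obtain ⟨e, p⟩ := x
  change len (exf _) ≤ _
  cases e
  · simp only [exf]; split_ifs <;> simp [len]; omega
  · simp [exf, len]

lemma app_inv {α : Type*} (e : Equiv.Perm α) (x : α) : e (e⁻¹ x) = x := by simp
lemma inv_app {α : Type*} (e : Equiv.Perm α) (x : α) : e⁻¹ (e x) = x := by simp

section fixfin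
variable {J : Type*} (a : J → Equiv.Perm (X k)) (φ : J → X k → Equiv.Perm (Fin (k+2)))

def act (l : J × Bool) : Equiv.Perm (X k) := cond l.2 (a l.1) (a l.1)⁻¹
def W (L : List (J × Bool)) : Equiv.Perm (X k) := (L.map (act a)).prod
def pt (l : J × Bool) (y : X k) : X k := cond l.2 y ((a l.1)⁻¹ y)
def ph (l : J × Bool) (y : X k) : Equiv.Perm (Fin (k+2)) :=
  cond l.2 (φ l.1 (pt a l y)) (φ l.1 (pt a l y))⁻¹
def Ph : List (J × Bool) → X k → Equiv.Perm (Fin (k+2))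
  | [], _ => 1
  | l :: L, x => ph a φ l (W a L x) * Ph L x

@[simp] lemma W_nil : W a [] = 1 := rfl
lemma W_cons (l) (L : List (J × Bool)) (x) : W a (l :: L) x = act a l (W a L x) := by
  simp [W]
lemma W_append (L L' : List (J × Bool)) (x) : W a (L ++ L') x = W a L (W a L' x) := by
  simp [W]

variable (h1 : ∀ j c x, 1 ≤ len x → a j (cons c x) = cons (φ j x c) (a j x))
  (h2 : ∀ j x, len (a j x) ≤ len x + 1 ∧ len x ≤ len (a j x) + 1)
include h1 h2

omit h1 in
lemma len_act (l) (x) : len (act a l x) ≤ len x + 1 ∧ len x ≤ len (act a l x) + 1 := by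
  obtain ⟨j, b⟩ := l
  cases b
  · have := h2 j ((a j)⁻¹ x)
    simp only [app_inv] at this
    simpa [act] using this.symm
  · simpa [act] using h2 j x

lemma act_cons (l c x) (hx : 2 ≤ len x) :
    act a l (cons c x) = cons (ph a φ l x c) (act a l x) := by
  obtain ⟨j, b⟩ := l
  cases b
  · have := h2 j ((a j)⁻¹ x)
    simp only [app_inv] at this
    simp only [act, ph, pt, cond_false]
    rw [Equiv.Perm.inv_eq_iff_eq, h1 _ _ _ (by omega)]
    simp
  · simpa [act, ph, pt] using h1 j c x (by omega)

omit h1 in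
lemma len_W (L : List (J × Bool)) (x) :
    len (W a L x) ≤ len x + L.length ∧ len x ≤ len (W a L x) + L.length := by
  induction L with
  | nil => simp
  | cons l L ih =>
    rw [W_cons]
    have := len_act a h2 l (W a L x)
    simp only [List.length_cons]; omega

lemma W_cons_vertex (L : List (J × Bool)) (c x) (hx : L.length + 1 ≤ len x) :
    W a L (cons c x) = cons (Ph a φ L x c) (W a L x) := by
  induction L with
  | nil => simp [Ph]
  | cons l L ih =>
    simp only [List.length_cons] at hx
    have := len_W a h2 L x
    rw [W_cons, W_cons, ih (by omega), act_cons a φ h1 h2 _ _ _ (by omega)]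
    rfl

lemma W_ext (L : List (J × Bool)) (v x) (hx : L.length + 1 ≤ len x) :
    ∃ v', v'.length = v.length ∧ W a L (ext v x) = ext v' (W a L x) := by
  induction v with
  | nil => exact ⟨[], rfl, rfl⟩
  | cons c v ih =>
    obtain ⟨v', h, h'⟩ := ih
    refine ⟨Ph a φ L (ext v x) c :: v', by simp [h], ?_⟩
    rw [ext_cons, W_cons_vertex a φ h1 h2 L c _ (by simp; omega), h', ext_cons]

omit h1 h2 in
lemma Ph_eq_one (L : List (J × Bool)) (x)
    (h : ∀ i (hi : i < L.length), φ L[i].1 (pt a L[i] (W a (L.drop (i+1)) x)) = 1) :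
    Ph a φ L x = 1 := by
  induction L with
  | nil => rfl
  | cons l L ih =>
    have h0 := h 0 (by simp)
    simp only [List.getElem_cons_zero, zero_add, List.drop_succ_cons, List.drop_zero] at h0
    rw [Ph, ih, ph, h0]
    · cases l.2 <;> simp
    · intro i hi
      have := h (i+1) (by simpa using hi)
      simpa using this

omit h1 h2 in
lemma pt_eq (L : List (J × Bool)) (x) (i : ℕ) (hi : i < L.length) :
    pt a L[i] (W a (L.drop (i+1)) x) = W a (L.drop (if L[i].2 then i+1 else i)) x := by
  by_cases hb : L[i].2 = true
  · simp [pt, hb]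
  · have hb : L[i].2 = false := by simpa using hb
    simp only [pt, hb, cond_false]
    rw [if_neg (by simp), List.drop_eq_getElem_cons hi, W_cons]
    simp [act, hb]

omit h1 h2 in
/-- distinctness -/
lemma pts_distinct (L : List (J × Bool)) (x) (hred : FreeGroup.IsReduced L)
    (hd : ∀ s t, s < t → t ≤ L.length → ¬ (s = 0 ∧ t = L.length) →
      W a (L.drop s) x ≠ W a (L.drop t) x)
    (i : ℕ) (hi0 : 0 < i) (hi : i < L.length) (hj : L[i].1 = (L[0]'(by omega)).1) :
    pt a L[i] (W a (L.drop (i+1)) x) ≠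
      pt a (L[0]'(by omega)) (W a (L.drop 1) x) := by
  intro he
  have key : ∀ s (hs : s < L.length), W a (L.drop s) x = act a L[s] (W a (L.drop (s+1)) x) := by
    intro s hs
    conv_lhs => rw [List.drop_eq_getElem_cons hs, W_cons]
  have hne : i = 1 → L[i].2 = (L[0]'(by omega)).2 := by
    intro h1
    subst h1
    have := (List.isChain_iff_getElem.1 hred) 0 (by omega)
    exact (this hj.symm).symm
  have k0 := key 0 (by omega)
  have ki := key i hi
  rcases hA : L[i] with ⟨j, b⟩
  rcases hB : (L[0]'(by omega)) with ⟨j', b'⟩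
  rw [hA, hB] at hj he
  rw [hA] at ki
  rw [hB] at k0
  rw [hA, hB] at hne
  simp only at hj
  subst hj
  simp only [pt] at he
  simp only [act] at k0 ki
  cases b <;> cases b' <;> simp only [cond_true, cond_false, zero_add] at he k0 ki hne
  · rw [← ki, ← k0] at he
    exact hd 0 i hi0 hi.le (by omega) he.symm
  · rw [← ki] at he
    have : i ≠ 1 := by intro h; simpa using hne h
    exact hd 1 i (by omega) hi.le (by omega) he.symm
  · rw [← k0] at he
    -- W drop (i+1) = W drop 0
    rw [he, k0] at ki
    simp only [app_inv] at ki
    have : i ≠ 1 := by intro h; simpa using hne h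
    exact hd 1 i (by omega) hi.le (by omega) ki.symm
  · exact hd 1 (i+1) (by omega) (by omega) (by omega) he.symm

variable (rot : Equiv.Perm (Fin (k+2))) (hrot : ∀ c, rot c ≠ c)
  (h3 : ∀ (j : J) (P : X k) (K : ℕ), ∃ m, K ≤ m ∧ ∀ j' x,
    (len x = m → (j' = j → (∃ v, x = ext v P) → φ j' x = rot) ∧
      (¬ (j' = j ∧ ∃ v, x = ext v P) → φ j' x = 1)) ∧
    (len x ≠ m → len x ≤ m + K → m ≤ len x + K → φ j' x = 1))
include hrot h3

lemma fix_finite (n : ℕ) : ∀ L : List (J × Bool), L.length = n → L ≠ [] → FreeGroup.IsReduced L →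
    {x | W a L x = x}.Finite := by
  induction n using Nat.strong_induction_on with
  | _ n ih =>
  intro L hL hne hred
  -- bad set
  have hbad : {x | ∃ s t, s < t ∧ t ≤ L.length ∧ ¬ (s = 0 ∧ t = L.length) ∧
      W a (L.drop s) x = W a (L.drop t) x}.Finite := by
    have : {x | ∃ s t, s < t ∧ t ≤ L.length ∧ ¬ (s = 0 ∧ t = L.length) ∧
      W a (L.drop s) x = W a (L.drop t) x} ⊆
      ⋃ s ∈ Finset.range (n+1), ⋃ t ∈ Finset.range (n+1),
        {x | (s < t ∧ t ≤ L.length ∧ ¬ (s = 0 ∧ t = L.length)) ∧ 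
          W a (L.drop s) x = W a (L.drop t) x} := by
      rintro x ⟨s, t, hst, ht, h0, he⟩
      simp only [Set.mem_iUnion, Finset.mem_range]
      exact ⟨s, by omega, t, by omega, ⟨hst, ht, h0⟩, he⟩
    refine Set.Finite.subset ?_ this
    refine Set.Finite.biUnion (Finset.finite_toSet _) fun s _ => ?_
    refine Set.Finite.biUnion (Finset.finite_toSet _) fun t _ => ?_
    by_cases hh : s < t ∧ t ≤ L.length ∧ ¬ (s = 0 ∧ t = L.length)
    · set v := (L.drop s).take (t - s) with hv
      have hdrop : L.drop s = v ++ L.drop t := by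
        rw [hv]
        conv_lhs => rw [← List.take_append_drop (t - s) (L.drop s)]
        rw [List.drop_drop]
        congr 2; omega
      have hvl : v.length = t - s := by simp [hv]; omega
      have hinf : v <:+: L := (List.take_prefix _ _).isInfix.trans (List.drop_suffix _ _).isInfix
      have hfin := ih v.length (by omega) v rfl
        (by intro h; rw [h] at hvl; simp at hvl; omega) (List.IsChain.infix hred hinf)
      refine (Set.Finite.preimage (f := W a (L.drop t)) (Equiv.injective _).injOn hfin).subset ?_
      rintro x ⟨_, he⟩
      rw [hdrop, W_append] at he
      exact he
    · refine Set.Finite.subset Set.finite_empty ?_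
      rintro x ⟨h, _⟩
      exact hh h
  obtain ⟨N0, hN0⟩ : ∃ N0, ∀ x, N0 ≤ len x → ∀ s t, s < t → t ≤ L.length →
      ¬ (s = 0 ∧ t = L.length) → W a (L.drop s) x ≠ W a (L.drop t) x := by
    obtain ⟨M, hM⟩ := (hbad.image len).bddAbove
    refine ⟨M + 1, fun x hx s t h1 h2 h3 h4 => ?_⟩
    have := hM (Set.mem_image_of_mem len (show x ∈ _ from ⟨s, t, h1, h2, h3, h4⟩))
    omega
  set N := N0 + L.length + 1 with hN
  have hdesc : ∀ v x, len x = N → W a L (ext v x) = ext v x → W a L x = x := by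
    intro v x hx hf
    obtain ⟨v', hv', he⟩ := W_ext a φ h1 h2 L v x (by omega)
    rw [he] at hf
    exact (ext_inj hv' hf).2
  have hbound : ∀ x, len x = N → ∃ M, ∀ v, W a L (ext v x) = ext v x → v.length ≤ M := by
    intro x hx
    obtain ⟨l, L', rfl⟩ := List.exists_cons_of_ne_nil hne
    set P := pt a l (W a L' x) with hP
    have hPw : P = W a ((l :: L').drop (if l.2 then 1 else 0)) x := by
      have := pt_eq a (l :: L') x 0 (by simp)
      simpa using this
    have hPl : len P ≤ len x + n := by
      rw [hPw]
      have := (len_W a h2 ((l :: L').drop (if l.2 then 1 else 0)) x).1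
      have h' : ((l :: L').drop (if l.2 then 1 else 0)).length ≤ n := by
        rw [List.length_drop]; omega
      omega
    obtain ⟨m, hm, hmm⟩ := h3 l.1 P (N + 2 * n + 2)
    refine ⟨m - len P, fun v hv => ?_⟩
    by_contra hlt
    push Not at hlt
    -- split v
    have hsp : v = v.take (v.length - (m - len P)) ++ v.drop (v.length - (m - len P)) := by simp
    set v2 := v.drop (v.length - (m - len P)) with hv2
    have hv2l : v2.length = m - len P := by simp [hv2]; omega
    set v1' := v.take (v.length - (m - len P)) with hv1
    have hv1l : v1'.length = v.length - (m - len P) := by simp [hv1]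
    obtain ⟨v1, c, hc⟩ : ∃ v1 c, v1' = v1 ++ [c] := by
      have : v1' ≠ [] := by intro h; rw [h] at hv1l; simp at hv1l; omega
      exact ⟨v1'.dropLast, v1'.getLast this, (List.dropLast_append_getLast this).symm⟩
    set x' := ext v2 x with hx'
    have hvx : ext v x = ext v1 (cons c x') := by
      rw [hsp, hc, ext_append, ext_append]; rfl
    rw [hvx] at hv
    obtain ⟨v', hv', he⟩ := W_ext a φ h1 h2 (l :: L') v1 (cons c x')
      (by simp only [len_cons, hx', len_ext]; omega)
    rw [he] at hv
    have hcx := (ext_inj hv' hv).2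
    rw [W_cons_vertex a φ h1 h2 _ c x' (by simp only [hx', len_ext]; omega)] at hcx
    have hPc := (cons_inj.1 hcx).1
    -- now compute Ph
    have hpts : ∀ i (hi : i < (l :: L').length), ∃ u,
        pt a (l :: L')[i] (W a ((l :: L').drop (i+1)) x') =
        ext u (pt a (l :: L')[i] (W a ((l :: L').drop (i+1)) x)) ∧ u.length = m - len P := by
      intro i hi
      rw [pt_eq, pt_eq]
      obtain ⟨u, hu, hu'⟩ := W_ext a φ h1 h2
        ((l :: L').drop (if (l :: L')[i].2 then i+1 else i)) v2 x (by
          rw [List.length_drop]; omega)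
      exact ⟨u, hu', by omega⟩
    have hrest : Ph a φ L' x' = 1 := by
      apply Ph_eq_one
      intro i hi
      obtain ⟨u, hu, hul⟩ := hpts (i+1) (by simpa using hi)
      simp only [List.getElem_cons_succ, List.drop_succ_cons] at hu
      set R := pt a L'[i] (W a (L'.drop (i+1)) x) with hR
      have hRl : len R ≤ len x + n ∧ len x ≤ len R + n := by
        have e := pt_eq a L' x i hi
        rw [← hR] at e
        rw [e]
        have := len_W a h2 (L'.drop (if L'[i].2 then i+1 else i)) x
        rw [List.length_drop] at this
        simp only [List.length_cons] at hL
        omega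
      have hPl' : len x ≤ len P + n := by
        rw [hPw]
        have := (len_W a h2 ((l :: L').drop (if l.2 then 1 else 0)) x).2
        rw [List.length_drop] at this
        omega
      rw [hu]
      obtain ⟨c1, c2⟩ := hmm L'[i].1 (ext u R)
      by_cases hlen : len R = len P
      · refine (c1 (by rw [len_ext]; omega)).2 ?_
        rintro ⟨hj, v3, hv3⟩
        have hRP : R = P := (ext_inj (by
          have := congrArg len hv3
          rw [len_ext, len_ext] at this; omega) hv3).2
        have := pts_distinct a (l :: L') x hred (hN0 x (by omega)) (i+1) (by omega)
          (by simpa using hi) (by simpa using hj)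
        apply this
        simpa [hR, hP] using hRP
      · exact c2 (by rw [len_ext]; omega) (by rw [len_ext]; omega) (by rw [len_ext]; omega)
    rw [Ph, hrest, mul_one] at hPc
    obtain ⟨u, hu, hul⟩ := hpts 0 (by simp)
    simp only [List.getElem_cons_zero, zero_add, List.drop_succ_cons, List.drop_zero] at hu
    rw [ph, hu, ((hmm l.1 (ext u P)).1 (by rw [len_ext]; omega)).1 rfl ⟨u, rfl⟩] at hPc
    cases hl2 : l.2 <;> rw [hl2] at hPc
    · simp only [cond_false] at hPc
      rw [Equiv.Perm.inv_eq_iff_eq] at hPc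
      exact hrot c hPc.symm
    · exact hrot c hPc
  choose! M hM using hbound
  have hsub : {x | W a L x = x} ⊆ {x | len x ≤ N} ∪
      ⋃ x ∈ {x : X k | len x ≤ N}, {y | len y ≤ M x + N} := by
    intro y hy
    by_cases hyl : len y ≤ N
    · exact Or.inl hyl
    · right
      obtain ⟨v, x, rfl, hx⟩ := exists_ext y N (by omega)
      simp only [Set.mem_iUnion]
      refine ⟨x, hx.le, ?_⟩
      have := hM x hx v hy
      simp only [Set.mem_ofPred_eq, len_ext]; omega
  exact ((finite_len N).union ((finite_len N).biUnion fun x _ => finite_len _)).subset hsub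

end fixfin

section dens

def nbr (x : X k) : Option (Fin (k+2)) → X k
  | none => par x
  | some c => cons c x

lemma par_ne_cons (x : X k) (c) : par x ≠ cons c x := by
  obtain ⟨e, p⟩ := x
  cases p with
  | nil => simp [par, cons]
  | cons a p =>
    intro h
    have := congrArg len h
    simp [par, cons, len] at this
    omega

lemma nbr_inj (x : X k) : Function.Injective (nbr x) := by
  intro i j h
  cases i <;> cases j
  · rfl
  · exact absurd h (par_ne_cons _ _)
  · exact absurd h.symm (par_ne_cons _ _)
  · rw [(cons_inj.1 h).1]

lemma eq_of_par {x y : X k} (h : par y = x) : y = par x ∨ ∃ c, y = cons c x := by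
  obtain ⟨e, p⟩ := y
  cases p with
  | nil => left; subst h; simp [par]
  | cons c p => right; exact ⟨c, by subst h; rfl⟩

lemma madj_iff_nbr {x y : X k} : madj x y ↔ ∃ i, y = nbr x i := by
  constructor
  · rintro (h | h)
    · exact ⟨none, h.symm⟩
    · rcases eq_of_par h with h | ⟨c, h⟩
      · exact ⟨none, h⟩
      · exact ⟨some c, h⟩
  · rintro ⟨i, rfl⟩
    cases i
    · exact Or.inl rfl
    · exact Or.inr rfl

lemma ind_perm (γ : Equiv.Perm (X k)) (hγ : ∀ x y, madj (γ x) (γ y) ↔ madj x y) (x : X k) :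
    ∃ τ : Equiv.Perm (Option (Fin (k+2))), ∀ i, γ (nbr x i) = nbr (γ x) (τ i) := by
  have : ∀ i, ∃ i', γ (nbr x i) = nbr (γ x) i' := fun i =>
    madj_iff_nbr.1 ((hγ _ _).2 (madj_iff_nbr.2 ⟨i, rfl⟩))
  choose f hf using this
  have hinj : Function.Injective f := by
    intro i j h
    apply nbr_inj x
    apply γ.injective
    rw [hf, hf, h]
  exact ⟨Equiv.ofBijective f (Finite.injective_iff_bijective.1 hinj), hf⟩

lemma cone_lemma (γ : Equiv.Perm (X k)) (hγ : ∀ x y, madj (γ x) (γ y) ↔ madj x y) (x : X k)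
    (hp : γ (par x) = par (γ x)) (v) :
    ∃ v', v'.length = v.length ∧ γ (ext v x) = ext v' (γ x) ∧
      γ (par (ext v x)) = par (γ (ext v x)) := by
  induction v with
  | nil => exact ⟨[], rfl, rfl, hp⟩
  | cons c v ih =>
    obtain ⟨v', h1, h2, h3⟩ := ih
    obtain ⟨τ, hτ⟩ := ind_perm γ hγ (ext v x)
    have hn := hτ none
    have hc := hτ (some c)
    cases hi : τ (some c) with
    | none =>
      rw [hi] at hc
      have : nbr (γ (ext v x)) none = γ (nbr (ext v x) none) := h3.symm
      rw [this] at hc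
      have := nbr_inj _ (γ.injective hc)
      simp at this
    | some c' =>
      rw [hi] at hc
      change γ (cons c (ext v x)) = cons c' (γ (ext v x)) at hc
      refine ⟨c' :: v', by simp [h1], ?_, ?_⟩
      · rw [ext_cons, hc, h2, ext_cons]
      · rw [ext_cons, hc, par_cons, par_cons]

variable (Γ : Subgroup (Equiv.Perm (X k)))
  (hA : ∀ γ ∈ Γ, ∀ x y, madj (γ x) (γ y) ↔ madj x y)
  (r1 : ∀ π : Equiv.Perm (Fin (k+2)), ∃ γ ∈ Γ, γ (false, []) = (false, []) ∧
    γ (true, []) = (true, []) ∧ ∀ c, γ (false, [c]) = (false, [π c]))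
  (r2 : ∃ γ ∈ Γ, γ (false, []) = (false, []) ∧ γ (true, []) = (false, [0]) ∧
    ∀ c, γ (false, [c]) = if c = 0 then (true, []) else (false, [c]))
  (r3 : ∃ γ ∈ Γ, γ (false, []) = (true, []))

def Re (τ : Equiv.Perm (Option (Fin (k+2)))) : Prop :=
  ∃ γ ∈ Γ, γ (false, []) = (false, []) ∧ ∀ i, γ (nbr (false, []) i) = nbr (false, []) (τ i)

lemma Re_mul {τ τ'} (h : Re Γ τ) (h' : Re Γ τ') : Re Γ (τ * τ') := by
  obtain ⟨γ, hm, h0, hi⟩ := h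
  obtain ⟨γ', hm', h0', hi'⟩ := h'
  exact ⟨γ * γ', Γ.mul_mem hm hm', by simp [h0, h0'], fun i => by simp [hi, hi']⟩

lemma Re_inv {τ} (h : Re Γ τ) : Re Γ τ⁻¹ := by
  obtain ⟨γ, hm, h0, hi⟩ := h
  refine ⟨γ⁻¹, Γ.inv_mem hm, ?_, fun i => ?_⟩
  · rw [Equiv.Perm.inv_eq_iff_eq, h0]
  · rw [Equiv.Perm.inv_eq_iff_eq, hi, app_inv]

include r1 in
lemma Re_opt (π : Equiv.Perm (Fin (k+2))) : Re Γ (Equiv.optionCongr π) := by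
  obtain ⟨γ, hm, h0, h1, h2⟩ := r1 π
  refine ⟨γ, hm, h0, fun i => ?_⟩
  cases i with
  | none => exact h1
  | some c => exact h2 c

include r1 r2 in
lemma Re_all (τ) : Re Γ τ := by
  have hs0 : Re Γ (Equiv.swap none (some 0)) := by
    obtain ⟨γ, hm, h0, h1, h2⟩ := r2
    refine ⟨γ, hm, h0, fun i => ?_⟩
    cases i with
    | none => rw [Equiv.swap_apply_left]; exact h1
    | some c =>
      refine (h2 c).trans ?_
      split_ifs with hc
      · subst hc; rw [Equiv.swap_apply_right]; rfl
      · rw [Equiv.swap_apply_of_ne_of_ne (by simp) (by simpa using hc)]; rfl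
  have hsc : ∀ c, Re Γ (Equiv.swap none (some c)) := by
    intro c
    have hf := Re_opt Γ r1 (Equiv.swap 0 c)
    have e := Equiv.mul_swap_eq_swap_mul (Equiv.optionCongr (Equiv.swap 0 c)) none (some 0)
    have : Equiv.swap none (some c) = Equiv.optionCongr (Equiv.swap 0 c) *
        Equiv.swap none (some 0) * (Equiv.optionCongr (Equiv.swap 0 c))⁻¹ := by
      rw [e]; simp
      rw [Equiv.swap_apply_of_ne_of_ne (by simp) (by simp)]
    rw [this]
    exact Re_mul Γ (Re_mul Γ hf hs0) (Re_inv Γ hf)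
  have hsw : ∀ i j, i ≠ j → Re Γ (Equiv.swap i j) := by
    intro i j hij
    cases i with
    | none => cases j with
      | none => exact absurd rfl hij
      | some c => exact hsc c
    | some c => cases j with
      | none => rw [Equiv.swap_comm]; exact hsc c
      | some c' =>
        have := Re_opt Γ r1 (Equiv.swap c c')
        rwa [Equiv.optionCongr_swap] at this
  induction τ using Equiv.Perm.swap_induction_on with
  | one => exact ⟨1, Γ.one_mem, rfl, fun i => rfl⟩
  | swap_mul f x y hxy ih => exact Re_mul Γ (hsw x y hxy) ih

include hA r1 r2 r3 in
lemma trans_o (x : X k) : ∃ γ ∈ Γ, γ (false, []) = x := by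
  have step : ∀ y y', madj y y' → (∃ γ ∈ Γ, γ (false, []) = y) → ∃ γ ∈ Γ, γ (false, []) = y' := by
    rintro y y' hyy ⟨γ, hm, rfl⟩
    have h1 : madj (false, []) (γ⁻¹ y') := by
      rw [← hA γ hm, app_inv]; exact hyy
    obtain ⟨i, hi⟩ := madj_iff_nbr.1 h1
    obtain ⟨s, hs, hs0, hs1⟩ := Re_all Γ r1 r2 (Equiv.swap none i)
    obtain ⟨f, hf, hf0⟩ := r3
    refine ⟨γ * s * f, Γ.mul_mem (Γ.mul_mem hm hs) hf, ?_⟩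
    have := hs1 none
    rw [Equiv.swap_apply_left, ← hi] at this
    change s (true, []) = _ at this
    simp only [Equiv.Perm.mul_apply, hf0, this, app_inv]
  obtain ⟨e, p⟩ := x
  induction p with
  | nil =>
    cases e
    · exact ⟨1, Γ.one_mem, rfl⟩
    · exact step _ _ (Or.inl rfl) ⟨1, Γ.one_mem, rfl⟩
  | cons c p ih => exact step (e, p) _ (Or.inr rfl) ih

include hA r1 r2 r3 in
lemma F1 (x y : X k) (τ : Equiv.Perm (Option (Fin (k+2)))) :
    ∃ γ ∈ Γ, γ x = y ∧ ∀ i, γ (nbr x i) = nbr y (τ i) := by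
  obtain ⟨γ1, hm1, rfl⟩ := trans_o Γ hA r1 r2 r3 x
  obtain ⟨γ2, hm2, rfl⟩ := trans_o Γ hA r1 r2 r3 y
  obtain ⟨τ1, ht1⟩ := ind_perm γ1 (hA _ hm1) (false, [])
  obtain ⟨τ2, ht2⟩ := ind_perm γ2 (hA _ hm2) (false, [])
  obtain ⟨s, hs, hs0, hs1⟩ := Re_all Γ r1 r2 (τ2⁻¹ * τ * τ1)
  refine ⟨γ2 * s * γ1⁻¹, Γ.mul_mem (Γ.mul_mem hm2 hs) (Γ.inv_mem hm1), ?_, fun i => ?_⟩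
  · simp only [Equiv.Perm.mul_apply, inv_app, hs0]
  · have : nbr (γ1 (false, [])) i = γ1 (nbr (false, []) (τ1⁻¹ i)) := by
      rw [ht1, app_inv]
    simp only [Equiv.Perm.mul_apply, this, inv_app, hs1, ht2, app_inv]

inductive Near (x : X k) : ℕ → X k → Prop
  | refl : Near x 0 x
  | step {n y y'} : Near x n y → madj y y' → Near x (n+1) y'

lemma Near.map {x y : X k} {n} (γ : Equiv.Perm (X k))
    (hγ : ∀ x y, madj (γ x) (γ y) ↔ madj x y) (h : Near x n y) : Near (γ x) n (γ y) := by
  induction h with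
  | refl => exact .refl
  | step _ hm ih => exact ih.step ((hγ _ _).2 hm)

lemma Near.trans {x y z : X k} {n m} (h : Near x n y) (h' : Near y m z) : Near x (n+m) z := by
  induction h' with
  | refl => exact h
  | step _ hm ih => exact ih.step hm

lemma near_down (x : X k) : Near x (len x) (x.1, []) := by
  obtain ⟨e, p⟩ := x
  induction p with
  | nil => exact .refl
  | cons c p ih =>
    have h : Near ((e, c :: p) : X k) 1 (e, p) := Near.step .refl (Or.inl rfl)
    have := h.trans ih
    rw [Nat.add_comm 1 (len _)] at this
    exact this

lemma near_up (x : X k) : Near (x.1, []) (len x) x := by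
  obtain ⟨e, p⟩ := x
  induction p with
  | nil => exact .refl
  | cons c p ih => exact ih.step (Or.inr rfl)

lemma near_any (x y : X k) : ∃ n, n ≤ len x + len y + 1 ∧ Near x n y := by
  by_cases h : x.1 = y.1
  · have := near_down x
    rw [h] at this
    exact ⟨_, by omega, this.trans (near_up y)⟩
  · have h' : madj ((x.1, []) : X k) (y.1, []) := by
      left
      simp only [par, Prod.mk.injEq, and_true]
      revert h; cases x.1 <;> cases y.1 <;> simp
    exact ⟨_, by omega, ((near_down x).step h').trans (near_up y)⟩

lemma near_zero (m : ℕ) (n : ℕ) (y : X k) (hn : n < m)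
    (h : Near ((false, List.replicate m 0) : X k) n y) :
    ∃ v, v.length ≤ 2 * n ∧ y = ext v (false, List.replicate (m - n) 0) := by
  induction h with
  | refl => exact ⟨[], by simp, rfl⟩
  | @step n y y' _ hm ih =>
    obtain ⟨v, hv, rfl⟩ := ih (by omega)
    have hrep : ((false, List.replicate (m - n) 0) : X k) =
        cons 0 (false, List.replicate (m - (n+1)) 0) := by
      have : m - n = (m - (n+1)) + 1 := by omega
      rw [this, List.replicate_succ]; rfl
    obtain ⟨i, rfl⟩ := madj_iff_nbr.1 hm
    rw [hrep]
    cases i with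
    | none =>
      cases v with
      | nil => exact ⟨[], by simp, rfl⟩
      | cons c v =>
        refine ⟨v ++ [0], by simp at hv ⊢; omega, ?_⟩
        rw [ext_append]; rfl
    | some c =>
      refine ⟨c :: (v ++ [0]), by simp; omega, ?_⟩
      rw [ext_cons, ext_append]; rfl

variable (φ : X k → Equiv.Perm (Fin (k+2))) (hb : tw φ ∈ Γ)
  (h4 : ∀ K : ℕ, ∃ m, K ≤ m ∧ ∀ x,
    (len x = m → (x = (false, List.replicate m 0) → φ x = Equiv.swap 0 1) ∧
      (x ≠ (false, List.replicate m 0) → φ x = 1)) ∧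
    (len x ≠ m → len x ≤ m + K → m ≤ len x + K → φ x = 1))

lemma tw_ext (v : List (Fin (k+2))) (x : X k)
    (h : ∀ y, len x ≤ len y → len y < len x + v.length → φ y = 1) :
    tw φ (ext v x) = ext v (tw φ x) := by
  induction v with
  | nil => rfl
  | cons c v ih =>
    rw [ext_cons, tw_cons, h _ (by simp) (by simp; omega), ih, ext_cons]
    · rfl
    · intro y h1 h2
      exact h y h1 (by simp; omega)

lemma len_tw_pow (i : ℕ) (x : X k) : len ((tw φ ^ i) x) = len x := by
  induction i with
  | zero => rfl
  | succ i ih => rw [pow_succ', Equiv.Perm.mul_apply, len_tw, ih]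

lemma tw_pow_ext (i : ℕ) (v : List (Fin (k+2))) (x : X k)
    (h : ∀ y, len x ≤ len y → len y < len x + v.length → φ y = 1) :
    (tw φ ^ i) (ext v x) = ext v ((tw φ ^ i) x) := by
  induction i with
  | zero => rfl
  | succ i ih =>
    rw [pow_succ', Equiv.Perm.mul_apply, ih, tw_ext, Equiv.Perm.mul_apply]
    intro y
    rw [len_tw_pow]
    exact h y

lemma exists_period (x : X k) : ∃ l, 0 < l ∧ (tw φ ^ l) x = x ∧
    ∀ i, 0 < i → i < l → (tw φ ^ i) x ≠ x := by
  have hex : ∃ l, 0 < l ∧ (tw φ ^ l) x = x := by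
    obtain ⟨i, j, hij, he⟩ := (finite_len (k := k) (len x)).exists_lt_map_eq_of_forall_mem
      (f := fun i : ℕ => (tw φ ^ i) x) (fun i => (len_tw_pow φ i x).le)
    refine ⟨j - i, by omega, ?_⟩
    apply (tw φ ^ i).injective
    rw [← Equiv.Perm.mul_apply, ← pow_add]
    rw [show i + (j - i) = j by omega]
    exact he.symm
  classical
  refine ⟨Nat.find hex, (Nat.find_spec hex).1, (Nat.find_spec hex).2, fun i hi hil he => ?_⟩
  exact Nat.find_min hex hil ⟨hi, he⟩

include h4 in
/-- a power of `b` acting locally as a transposition -/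
lemma local_swap (r : ℕ) : ∃ m l, r < m ∧ ∀ v : List (Fin (k+2)), v.length ≤ 2 * r →
    (let z : X k := (false, List.replicate m 0)
     let y := ext v (false, List.replicate (m - r) 0)
     (tw φ ^ l) (cons 0 z) = cons 1 z ∧ (tw φ ^ l) (cons 1 z) = cons 0 z ∧
     ((∀ u, y ≠ ext u (cons 0 z)) → (∀ u, y ≠ ext u (cons 1 z)) → (tw φ ^ l) y = y)) := by
  obtain ⟨m, hm, hφ⟩ := h4 (2 * r + 2)
  set A : X k := (false, List.replicate (m - r) 0) with hAdef
  have hAl : len A = m - r := by simp [hAdef, len]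
  obtain ⟨l, hl0, hl, hlmin⟩ := exists_period φ A
  set z : X k := (false, List.replicate m 0) with hz
  have hzA : z = ext (List.replicate r 0) A := by
    simp only [hz, hAdef, ext, Prod.mk.injEq, true_and]
    rw [List.replicate_append_replicate]
    congr 1; omega
  have lev : ∀ i (v : List (Fin (k+2))), v.length ≤ r →
      (tw φ ^ i) (ext v A) = ext v ((tw φ ^ i) A) := by
    intro i v hv
    apply tw_pow_ext
    intro y h1 h2
    exact (hφ y).2 (by omega) (by omega) (by omega)
  -- level m+1
  have lev1 : ∀ i (v : List (Fin (k+2))) c, v.length = r → i ≤ l → 0 < i →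
      (tw φ ^ i) (cons c (ext v A)) =
        cons ((if v = List.replicate r 0 then Equiv.swap 0 1 else 1 : Equiv.Perm _) c)
          (ext v ((tw φ ^ i) A)) := by
    intro i v c hv
    induction i with
    | zero => intro _ h; omega
    | succ i ih =>
      intro hil _
      by_cases hi : i = 0
      · subst hi
        simp only [zero_add, pow_one]
        have h1 := lev 1 v hv.le
        rw [pow_one] at h1
        rw [tw_cons, h1]
        congr 2
        have := (hφ (ext v A)).1 (by rw [len_ext]; omega)
        split_ifs with hv0
        · exact this.1 (by rw [hv0, ← hzA])
        · refine this.2 ?_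
          change ext v A ≠ z
          rw [hzA]
          intro h
          exact hv0 (ext_inj (by simp [hv]) h).1
      · rw [pow_succ', Equiv.Perm.mul_apply, ih (by omega) (by omega), tw_cons]
        have e1 : φ (ext v ((tw φ ^ i) A)) = 1 := by
          refine ((hφ _).1 (by rw [len_ext, len_tw_pow]; omega)).2 ?_
          change _ ≠ z
          rw [hzA]
          intro h
          exact hlmin i (by omega) (by omega) (ext_inj (by simp [hv]) h).2
        have e2 : tw φ (ext v ((tw φ ^ i) A)) = ext v ((tw φ ^ (i+1)) A) := by
          rw [← lev (i+1) v hv.le, ← lev i v hv.le, pow_succ', Equiv.Perm.mul_apply]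
        rw [e1, e2, pow_succ', Equiv.Perm.mul_apply]
        rfl
  refine ⟨m, l, by omega, fun v hv => ⟨?_, ?_, ?_⟩⟩
  · have := lev1 l (List.replicate r 0) 0 (by simp) le_rfl hl0
    rw [hl, ← hzA] at this
    simpa using this
  · have := lev1 l (List.replicate r 0) 1 (by simp) le_rfl hl0
    rw [hl, ← hzA] at this
    simpa using this
  · intro hn0 hn1
    by_cases hvr : v.length ≤ r
    · rw [lev l v hvr, hl]
    · have hsp : v = v.take (v.length - (r+1)) ++ v.drop (v.length - (r+1)) := by simp
      set v1 := v.take (v.length - (r+1)) with hv1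
      have hv1l : v1.length = v.length - (r+1) := by simp [hv1]
      have hv2l : (v.drop (v.length - (r+1))).length = r + 1 := by simp; omega
      obtain ⟨c, v2, hc⟩ : ∃ c v2, v.drop (v.length - (r+1)) = c :: v2 := by
        apply List.exists_cons_of_ne_nil
        intro h; rw [h] at hv2l; simp at hv2l
      rw [hc] at hv2l hsp
      have hv2 : v2.length = r := by simpa using hv2l
      have hy : ext v A = ext v1 (cons c (ext v2 A)) := by
        rw [hsp, ext_append]; rfl
      rw [hy] at hn0 hn1 ⊢
      rw [tw_pow_ext, lev1 l v2 c hv2 le_rfl hl0, hl]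
      · congr 2
        split_ifs with h0
        · rw [h0, ← hzA] at hn0 hn1
          apply Equiv.swap_apply_of_ne_of_ne
          · rintro rfl; exact hn0 _ rfl
          · rintro rfl; exact hn1 _ rfl
        · rfl
      · intro y h1 h2
        simp only [len_cons, len_ext] at h1 h2
        exact (hφ y).2 (by omega) (by omega) (by omega)

lemma exists_perm3 {α : Type*} [DecidableEq α] (a b c a' b' c' : α) (h1 : a ≠ b) (h2 : a ≠ c) (h3 : b ≠ c)
    (h1' : a' ≠ b') (h2' : a' ≠ c') (h3' : b' ≠ c') :
    ∃ τ : Equiv.Perm α, τ a = a' ∧ τ b = b' ∧ τ c = c' := by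
  let s1 := Equiv.swap a a'
  let s2 := Equiv.swap (s1 b) b'
  let s3 := Equiv.swap (s2 (s1 c)) c'
  have ha : s1 a = a' := Equiv.swap_apply_left _ _
  have hb : s2 (s1 b) = b' := Equiv.swap_apply_left _ _
  have hab : s2 a' = a' := Equiv.swap_apply_of_ne_of_ne
    (by rw [← ha]; exact fun h => h1 (s1.injective h)) h1'
  refine ⟨s3 * s2 * s1, ?_, ?_, ?_⟩
  · simp only [Equiv.Perm.mul_apply, ha, hab]
    refine Equiv.swap_apply_of_ne_of_ne ?_ h2'
    rw [← hab, ← ha]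
    exact fun h => h2 (s1.injective (s2.injective h))
  · simp only [Equiv.Perm.mul_apply, hb]
    refine Equiv.swap_apply_of_ne_of_ne ?_ h3'
    rw [← hb]
    exact fun h => h3 (s1.injective (s2.injective h))
  · exact Equiv.swap_apply_left _ _

include hA r1 r2 r3 hb h4 in
lemma F2 (x : X k) (c c' : Fin (k+2)) (hc : c ≠ c') : ∃ γ ∈ Γ, ∀ y, len y ≤ len x + 1 →
    γ y = Equiv.swap (cons c x) (cons c' x) y := by
  set r := 2 * len x + 2 with hr
  obtain ⟨m, l, hm, hl⟩ := local_swap φ h4 r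
  set z : X k := (false, List.replicate m 0) with hz
  obtain ⟨τ, ht1, ht2, ht3⟩ := exists_perm3 (none : Option (Fin (k+2))) (some c) (some c')
    none (some 0) (some 1) (by simp) (by simp) (by simpa using hc) (by simp) (by simp) (by simp)
  obtain ⟨u, hu, hux, hun⟩ := F1 Γ hA r1 r2 r3 x z τ
  have hup : u (par x) = par z := by have := hun none; rwa [ht1] at this
  have hu0 : u (cons c x) = cons 0 z := by have := hun (some c); rwa [ht2] at this
  have hu1 : u (cons c' x) = cons 1 z := by have := hun (some c'); rwa [ht3] at this
  refine ⟨u⁻¹ * tw φ ^ l * u, Γ.mul_mem (Γ.mul_mem (Γ.inv_mem hu) (Γ.pow_mem hb l)) hu,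
    fun y hy => ?_⟩
  simp only [Equiv.Perm.mul_apply]
  rw [Equiv.Perm.inv_eq_iff_eq]
  have h00 := hl [] (by simp)
  by_cases hy0 : y = cons c x
  · subst hy0
    rw [Equiv.swap_apply_left, hu0, hu1]
    exact h00.1
  by_cases hy1 : y = cons c' x
  · subst hy1
    rw [Equiv.swap_apply_right, hu0, hu1]
    exact h00.2.1
  rw [Equiv.swap_apply_of_ne_of_ne hy0 hy1]
  obtain ⟨n, hn, hnear⟩ := near_any x y
  have hnz := hnear.map u (hA u hu)
  rw [hux] at hnz
  obtain ⟨v, hv, hvy⟩ := near_zero m n (u y) (by omega) hnz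
  have hvy' : u y = ext (v ++ List.replicate (r - n) 0) (false, List.replicate (m - r) 0) := by
    rw [hvy]
    simp only [ext, Prod.mk.injEq, true_and, List.append_assoc, List.replicate_append_replicate]
    congr 2; omega
  have hcone : ∀ (d : Fin (k+2)) (e : Fin (k+2)), u (cons d x) = cons e z → y ≠ cons d x →
      ∀ w, u y ≠ ext w (cons e z) := by
    intro d e hde hyd w hw
    have hinv : ∀ x y, madj (u⁻¹ x) (u⁻¹ y) ↔ madj x y := hA _ (Γ.inv_mem hu)
    have hiz : u⁻¹ (cons e z) = cons d x := by rw [Equiv.Perm.inv_eq_iff_eq, hde]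
    obtain ⟨w', hw', hw2, -⟩ := cone_lemma u⁻¹ hinv (cons e z) (by
      rw [hiz, par_cons, par_cons, Equiv.Perm.inv_eq_iff_eq, hux]) w
    rw [← hw, inv_app, hiz] at hw2
    have hlen := congrArg len hw2
    rw [len_ext, len_cons] at hlen
    have : w' = [] := List.eq_nil_of_length_eq_zero (by omega)
    rw [this] at hw2
    exact hyd hw2
  have := (hl (v ++ List.replicate (r - n) 0) (by simp; omega)).2.2
  rw [← hvy'] at this
  exact this (hcone c 0 hu0 hy0) (hcone c' 1 hu1 hy1)

include hA r1 r2 r3 hb h4 in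
lemma dense_ball (N : ℕ) : ∀ g : Equiv.Perm (X k), (∀ x y, madj (g x) (g y) ↔ madj x y) →
    ∃ γ ∈ Γ, ∀ y, len y ≤ N → γ y = g y := by
  induction N with
  | zero =>
    intro g hg
    obtain ⟨τ, hτ⟩ := ind_perm g hg (false, [])
    obtain ⟨γ, hm, h0, h1⟩ := F1 Γ hA r1 r2 r3 (false, []) (g (false, [])) τ
    refine ⟨γ, hm, ?_⟩
    rintro ⟨e, p⟩ hy
    have hp : p = [] := List.eq_nil_of_length_eq_zero (by simpa [len] using hy)
    subst hp
    cases e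
    · exact h0
    · exact (h1 none).trans (hτ none).symm
  | succ N ih =>
    -- elements fixing the ball of radius N
    have key : ∀ n : ℕ, ∀ h : Equiv.Perm (X k), (∀ x y, madj (h x) (h y) ↔ madj x y) →
        (∀ y, len y ≤ N → h y = y) → {y | len y ≤ N + 1 ∧ h y ≠ y}.ncard = n →
        ∃ γ ∈ Γ, ∀ y, len y ≤ N + 1 → γ y = h y := by
      intro n
      induction n using Nat.strong_induction_on with
      | _ n ihn =>
      intro h hh hfix hn
      by_cases hex : ∃ y, len y ≤ N + 1 ∧ h y ≠ y
      · obtain ⟨y, hy, hne⟩ := hex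
        have hyl : len y = N + 1 := by
          by_contra h'
          exact hne (hfix y (by omega))
        obtain ⟨x, c, rfl⟩ : ∃ x c, y = cons c x := by
          obtain ⟨e, p⟩ := y
          cases p with
          | nil => simp [len] at hyl
          | cons c p => exact ⟨(e, p), c, rfl⟩
        rw [len_cons] at hyl
        have hx : h x = x := hfix x (by omega)
        obtain ⟨c', hc'⟩ : ∃ c', h (cons c x) = cons c' x := by
          have : madj x (h (cons c x)) := by
            rw [← hx, hh, hx]; exact Or.inr rfl
          obtain ⟨i, hi⟩ := madj_iff_nbr.1 this
          cases i with
          | some c' => exact ⟨c', hi⟩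
          | none =>
            exfalso
            by_cases hlx : len (par x) ≤ N
            · have := hfix _ hlx
              change h (cons c x) = par x at hi
              rw [← this] at hi
              exact par_ne_cons x c (h.injective hi).symm
            · obtain ⟨e, p⟩ := x
              cases p <;> simp [len, par] at hlx hyl
              omega
        have hcc : c ≠ c' := by rintro rfl; exact hne hc'
        obtain ⟨γ, hm, hγ⟩ := F2 Γ hA r1 r2 r3 φ hb h4 x c c' hcc
        have hγ' : ∀ y, len y ≤ N + 1 → γ y = Equiv.swap (cons c x) (cons c' x) y :=
          fun y hy => hγ y (by omega)
        have hlen : ∀ y, len y ≤ N + 1 → len (h y) ≤ N + 1 := by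
          intro y hy
          by_cases hyN : len y ≤ N
          · rw [hfix y hyN]; exact hy
          · obtain ⟨e, p⟩ := y
            cases p with
            | nil => simp [len] at hyN
            | cons a p =>
              have hp : h (e, p) = (e, p) := hfix _ (by simp [len] at hy ⊢; omega)
              have : madj (e, p) (h (e, a :: p)) := by
                rw [← hp, hh]; exact Or.inr rfl
              obtain ⟨i, hi⟩ := madj_iff_nbr.1 this
              rw [hi]
              cases i with
              | none => cases p <;> simp [nbr, par, len] at hy ⊢; omega
              | some a' => simp [nbr, cons, len] at hy ⊢; omega
        obtain ⟨γ2, hm2, hγ2⟩ := ihn ({y | len y ≤ N + 1 ∧ (γ * h) y ≠ y}.ncard) (by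
            rw [← hn]
            apply Set.ncard_lt_ncard
            · refine ⟨?_, ?_⟩
              · rintro y ⟨hy, hy'⟩
                refine ⟨hy, fun hy2 => hy' ?_⟩
                rw [Equiv.Perm.mul_apply, hy2, hγ' y hy]
                apply Equiv.swap_apply_of_ne_of_ne
                · rintro rfl; exact hne hy2
                · rintro rfl
                  rw [← hc'] at hy2
                  exact hne (h.injective hy2)
              · intro hsub
                have := hsub (show cons c x ∈ _ from ⟨hy, hne⟩)
                apply this.2
                rw [Equiv.Perm.mul_apply, hc', hγ' _ (by simp; omega), Equiv.swap_apply_right]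
            · exact (finite_len (N+1)).subset fun y hy => hy.1) (γ * h) (by
            intro y y'
            rw [Equiv.Perm.mul_apply, Equiv.Perm.mul_apply, hA γ hm, hh]) (by
            intro y hy
            rw [Equiv.Perm.mul_apply, hfix y hy, hγ' y (by omega)]
            apply Equiv.swap_apply_of_ne_of_ne <;>
            · rintro rfl
              simp at hy; omega) rfl
        refine ⟨γ⁻¹ * γ2, Γ.mul_mem (Γ.inv_mem hm) hm2, fun y hy => ?_⟩
        rw [Equiv.Perm.mul_apply, hγ2 y hy, Equiv.Perm.mul_apply, inv_app]
      · push Not at hex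
        exact ⟨1, Γ.one_mem, fun y hy => (hex y hy).symm⟩
    intro g hg
    obtain ⟨γ, hm, hγ⟩ := ih g hg
    obtain ⟨γ2, hm2, hγ2⟩ := key _ (γ⁻¹ * g) (by
      intro x y
      rw [Equiv.Perm.mul_apply, Equiv.Perm.mul_apply, hA _ (Γ.inv_mem hm), hg]) (by
      intro y hy
      rw [Equiv.Perm.mul_apply, ← hγ y hy, inv_app]) rfl
    refine ⟨γ * γ2, Γ.mul_mem hm hm2, fun y hy => ?_⟩
    rw [Equiv.Perm.mul_apply, hγ2 y hy, Equiv.Perm.mul_apply, app_inv]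

end dens

section concrete

abbrev J (k : ℕ) := Equiv.Perm (Fin (k+2)) ⊕ Bool

def rot : Equiv.Perm (Fin (k+2)) := Equiv.addRight 1

lemma rot_ne (c : Fin (k+2)) : rot c ≠ c := by
  simp [rot]

open Classical in
noncomputable def fi (s : ℕ → Option (J k × X k)) (j : J k) (x : X k) : Equiv.Perm (Fin (k+2)) :=
  if len x = 0 then
    match j with
    | .inl π => if x = (false, []) then π else 1
    | .inr _ => 1
  else if len x = 2 ^ Nat.log 2 (len x) then
    match s (Nat.unpair (Nat.log 2 (len x))).1 with
    | some q => if j = q.1 ∧ ∃ v, x = ext v q.2 then rot else 1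
    | none => if j = .inl 1 ∧ x = (false, List.replicate (len x) 0) then Equiv.swap 0 1 else 1
  else 1

def bs : J k → Equiv.Perm (X k)
  | .inl _ => 1
  | .inr false => flip
  | .inr true => ex

noncomputable def gen (s : ℕ → Option (J k × X k)) (j : J k) : Equiv.Perm (X k) :=
  bs j * tw (fi s j)

lemma madj_bs (j : J k) (x y) : madj (bs j x) (bs j y) ↔ madj x y := by
  rcases j with π | (_ | _)
  · rfl
  · exact madj_flip x y
  · exact madj_ex x y

lemma bs_cons (j : J k) (c x) (h : 1 ≤ len x) : bs j (cons c x) = cons c (bs j x) := by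
  rcases j with π | (_ | _)
  · rfl
  · rfl
  · exact ex_cons c x h

lemma len_bs (j : J k) (x) : len (bs j x) ≤ len x + 1 ∧ len x ≤ len (bs j x) + 1 := by
  rcases j with π | (_ | _)
  · change len x ≤ len x + 1 ∧ len x ≤ len x + 1
    omega
  · change len x ≤ len x + 1 ∧ len x ≤ len x + 1
    omega
  · refine ⟨len_ex x, ?_⟩
    have := len_ex (ex x)
    rwa [ex_ex] at this

lemma madj_gen (s) (j : J k) (x y) : madj (gen s j x) (gen s j y) ↔ madj x y := by
  simp only [gen, Equiv.Perm.mul_apply, madj_bs, madj_tw]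

lemma gen_h1 (s) (j : J k) (c x) (h : 1 ≤ len x) :
    gen s j (cons c x) = cons (fi s j x c) (gen s j x) := by
  simp only [gen, Equiv.Perm.mul_apply, tw_cons]
  rw [bs_cons]
  rw [len_tw]; exact h

lemma gen_h2 (s) (j : J k) (x) :
    len (gen s j x) ≤ len x + 1 ∧ len x ≤ len (gen s j x) + 1 := by
  have := len_bs j (tw (fi s j) x)
  rw [len_tw] at this
  exact this

lemma fi_off (s) (j : J k) (x) (h0 : 1 ≤ len x) (h : ∀ c, len x ≠ 2 ^ c) : fi s j x = 1 := by
  unfold fi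
  rw [if_neg (by omega), if_neg (h _)]

lemma fi_some (s) (j : J k) (x c q) (h : len x = 2 ^ c) (hs : s (Nat.unpair c).1 = some q) :
    ((j = q.1 ∧ ∃ v, x = ext v q.2) → fi s j x = rot) ∧
    (¬ (j = q.1 ∧ ∃ v, x = ext v q.2) → fi s j x = 1) := by
  have hl : Nat.log 2 (len x) = c := by rw [h, Nat.log_pow (by norm_num)]
  have h0 : len x ≠ 0 := by rw [h]; positivity
  unfold fi
  rw [if_neg h0, hl, if_pos h, hs]
  constructor <;> intro h'
  · simp only [if_pos h']
  · simp only [if_neg h']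

lemma fi_none (s) (j : J k) (x c) (h : len x = 2 ^ c) (hs : s (Nat.unpair c).1 = none) :
    ((j = .inl 1 ∧ x = (false, List.replicate (len x) 0)) → fi s j x = Equiv.swap 0 1) ∧
    (¬ (j = .inl 1 ∧ x = (false, List.replicate (len x) 0)) → fi s j x = 1) := by
  have hl : Nat.log 2 (len x) = c := by rw [h, Nat.log_pow (by norm_num)]
  have h0 : len x ≠ 0 := by rw [h]; positivity
  unfold fi
  rw [if_neg h0, hl, if_pos h, hs]
  constructor <;> intro h'
  · simp only [if_pos h']
  · simp only [if_neg h']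

lemma pow_iso (c c' K : ℕ) (h : 2 * K + 2 ≤ c) (h1 : 2 ^ c' ≤ 2 ^ c + K) (h2 : 2 ^ c ≤ 2 ^ c' + K) :
    c' = c := by
  have hc : 2 * K + 2 < 2 ^ c := lt_of_le_of_lt h Nat.lt_two_pow_self
  rcases lt_trichotomy c' c with hl | hl | hl
  · have : 2 ^ (c' + 1) ≤ 2 ^ c := Nat.pow_le_pow_right (by norm_num) hl
    rw [pow_succ] at this
    omega
  · exact hl
  · have : 2 ^ (c + 1) ≤ 2 ^ c' := Nat.pow_le_pow_right (by norm_num) hl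
    rw [pow_succ] at this
    omega

lemma fi_iso (s) (j : J k) (x) (c K : ℕ) (hK : 2 * K + 2 ≤ c) (hne : len x ≠ 2 ^ c)
    (h1 : len x ≤ 2 ^ c + K) (h2 : 2 ^ c ≤ len x + K) : fi s j x = 1 := by
  have hc : 2 * K + 2 < 2 ^ c := lt_of_le_of_lt hK Nat.lt_two_pow_self
  apply fi_off _ _ _ (by omega)
  intro c' hc'
  have := pow_iso c c' K hK (by omega) (by omega)
  rw [this] at hc'
  exact hne hc'

lemma exists_code (s : ℕ → Option (J k × X k)) (hs : Function.Surjective s) (o) (K : ℕ) :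
    ∃ c, 2 * K + 2 ≤ c ∧ K ≤ 2 ^ c ∧ s (Nat.unpair c).1 = o := by
  obtain ⟨n, rfl⟩ := hs o
  have h1 : 2 * K + 2 ≤ Nat.pair n (2 * K + 2) := Nat.right_le_pair _ _
  refine ⟨Nat.pair n (2 * K + 2), h1, ?_, by simp⟩
  have := Nat.lt_two_pow_self (n := Nat.pair n (2 * K + 2))
  omega

lemma gen_h3 (s : ℕ → Option (J k × X k)) (hs : Function.Surjective s) (j : J k) (P : X k) (K : ℕ) :
    ∃ m, K ≤ m ∧ ∀ j' x, (len x = m → (j' = j → (∃ v, x = ext v P) → fi s j' x = rot) ∧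
      (¬ (j' = j ∧ ∃ v, x = ext v P) → fi s j' x = 1)) ∧
      (len x ≠ m → len x ≤ m + K → m ≤ len x + K → fi s j' x = 1) := by
  obtain ⟨c, hc, hK, hsc⟩ := exists_code s hs (some (j, P)) K
  refine ⟨2 ^ c, hK, fun j' x => ⟨fun h => ⟨fun h1 h2 => ?_, fun h1 => ?_⟩, fun h1 h2 h3 => ?_⟩⟩
  · exact (fi_some s j' x c _ h hsc).1 ⟨h1, h2⟩
  · exact (fi_some s j' x c _ h hsc).2 h1
  · exact fi_iso s j' x c K hc h1 h2 h3

lemma gen_h4 (s : ℕ → Option (J k × X k)) (hs : Function.Surjective s) (K : ℕ) :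
    ∃ m, K ≤ m ∧ ∀ x,
    (len x = m → (x = (false, List.replicate m 0) → fi s (.inl 1) x = Equiv.swap 0 1) ∧
      (x ≠ (false, List.replicate m 0) → fi s (.inl 1) x = 1)) ∧
    (len x ≠ m → len x ≤ m + K → m ≤ len x + K → fi s (.inl 1) x = 1) := by
  obtain ⟨c, hc, hK, hsc⟩ := exists_code s hs none K
  refine ⟨2 ^ c, hK, fun x => ⟨fun h => ⟨fun h1 => ?_, fun h1 => ?_⟩, fun h1 h2 h3 => ?_⟩⟩
  · exact (fi_none s _ x c h hsc).1 ⟨rfl, by rw [h]; exact h1⟩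
  · refine (fi_none s _ x c h hsc).2 (fun h' => h1 ?_)
    have := h'.2
    rwa [h] at this
  · exact fi_iso s _ x c K hc h1 h2 h3

lemma lift_W (a : J k → Equiv.Perm (X k)) (w : FreeGroup (J k)) :
    FreeGroup.lift a w = W a w.toWord := by
  conv_lhs => rw [← FreeGroup.mk_toWord (x := w)]
  rw [FreeGroup.lift_mk]
  rfl

theorem model (k : ℕ) : ∃ a : J k → Equiv.Perm (X k),
    (∀ j x y, madj (a j x) (a j y) ↔ madj x y) ∧
    (∀ w : FreeGroup (J k), w ≠ 1 → {x | FreeGroup.lift a w x = x}.Finite) ∧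
    (∀ g : Equiv.Perm (X k), (∀ x y, madj (g x) (g y) ↔ madj x y) → ∀ N : ℕ,
      ∃ w : FreeGroup (J k), ∀ y, len y ≤ N → FreeGroup.lift a w y = g y) := by
  obtain ⟨s, hs⟩ := exists_surjective_nat (Option (J k × X k))
  refine ⟨gen s, madj_gen s, fun w hw => ?_, fun g hg N => ?_⟩
  · rw [lift_W]
    exact fix_finite (gen s) (fi s) (gen_h1 s) (gen_h2 s) rot rot_ne (gen_h3 s hs)
      _ w.toWord rfl (by simpa using hw) FreeGroup.isReduced_toWord
  · have hm : ∀ j, gen s j ∈ (FreeGroup.lift (gen s)).range := fun j =>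
      ⟨FreeGroup.of j, by simp⟩
    obtain ⟨γ, ⟨w, hw⟩, h⟩ := dense_ball (FreeGroup.lift (gen s)).range (by
      rintro _ ⟨w, rfl⟩
      induction w using FreeGroup.induction_on with
      | C1 => intro x y; simp
      | of j => intro x y; simp only [FreeGroup.lift_apply_of]; exact madj_gen s j x y
      | inv_of j ih =>
        intro x y
        rw [map_inv, ← ih, app_inv, app_inv]
      | mul u v ih1 ih2 =>
        intro x y
        rw [map_mul, Equiv.Perm.mul_apply, Equiv.Perm.mul_apply, ih1, ih2])
      (fun π => ⟨_, hm (.inl π), rfl, rfl, fun c => by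
        change ((false, [fi s (.inl π) (false, []) c]) : X k) = _
        simp [fi, len]⟩)
      ⟨_, hm (.inr true), ex_nil_false, ex_nil_true, fun c => by
        have : gen s (.inr true) (false, [c]) = ex (false, [fi s (.inr true) (false, []) c]) := rfl
        rw [this, ← ex_one]
        simp [fi, len]⟩
      ⟨_, hm (.inr false), rfl⟩ (fi s (.inl 1)) (hm (.inl 1)) (gen_h4 s hs) N g hg
    exact ⟨w, fun y hy => by rw [hw]; exact h y hy⟩

end concrete

section iso

variable {V : Type*} {G : SimpleGraph V}

lemma closer_unique (hc : G.Connected) (ha : G.IsAcyclic) {r u w v : V} (hu : G.Adj u v)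
    (hw : G.Adj w v) (h1 : G.dist r v = G.dist r u + 1) (h2 : G.dist r v = G.dist r w + 1) :
    u = w := by
  obtain ⟨p, hp⟩ := hc.exists_walk_length_eq_dist r u
  obtain ⟨q, hq⟩ := hc.exists_walk_length_eq_dist r w
  have hpp : (p.concat hu).IsPath := SimpleGraph.Walk.isPath_of_length_eq_dist _ (by
    rw [SimpleGraph.Walk.length_concat, hp, h1])
  have hqq : (q.concat hw).IsPath := SimpleGraph.Walk.isPath_of_length_eq_dist _ (by
    rw [SimpleGraph.Walk.length_concat, hq, h2])
  have := congrArg Subtype.val (ha.path_unique ⟨_, hpp⟩ ⟨_, hqq⟩)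
  exact (SimpleGraph.Walk.concat_inj this).1

lemma exists_enum (hd : ∀ v : V, (G.neighborSet v).ncard = k + 3) (v u : V) (h : G.Adj v u) :
    ∃ f : Option (Fin (k+2)) → V, f none = u ∧ Function.Injective f ∧
      ∀ w, G.Adj v w ↔ ∃ i, w = f i := by
  have hf : (G.neighborSet v).Finite := Set.finite_of_ncard_ne_zero (by rw [hd]; omega)
  have hcard : Nat.card (Option (Fin (k+2))) = Nat.card (G.neighborSet v) := by
    rw [Nat.card_coe_set_eq, hd]; simp
  haveI : Finite (G.neighborSet v) := hf
  classical
  let e0 : Option (Fin (k+2)) ≃ G.neighborSet v := Classical.choice (Finite.card_eq.1 hcard)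
  let e := e0.trans (Equiv.swap (e0 none) ⟨u, h⟩)
  refine ⟨fun i => (e i : V), ?_, Subtype.val_injective.comp e.injective, fun w => ⟨fun hw => ?_, ?_⟩⟩
  · simp [e]
  · exact ⟨e.symm ⟨w, hw⟩, by simp⟩
  · rintro ⟨i, rfl⟩
    exact (e i).2

lemma exists_iso (hc : G.Connected) (ha : G.IsAcyclic)
    (hd : ∀ v : V, (G.neighborSet v).ncard = k + 3) :
    ∃ Ψ : X k ≃ V, ∀ x y, G.Adj (Ψ x) (Ψ y) ↔ madj x y := by
  classical
  obtain ⟨v0⟩ := hc.nonempty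
  obtain ⟨v1, hv1⟩ : (G.neighborSet v0).Nonempty :=
    Set.nonempty_of_ncard_ne_zero (by rw [hd]; omega)
  change G.Adj v0 v1 at hv1
  have : ∀ v u, ∃ f : Option (Fin (k+2)) → V, G.Adj v u → f none = u ∧ Function.Injective f ∧
      ∀ w, G.Adj v w ↔ ∃ i, w = f i := by
    intro v u
    by_cases h : G.Adj v u
    · obtain ⟨f, hf⟩ := exists_enum hd v u h
      exact ⟨f, fun _ => hf⟩
    · exact ⟨fun _ => v, fun h' => absurd h' h⟩
  choose N hN using this
  let Q0 : Bool → List (Fin (k+2)) → V × V := fun e p =>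
    List.rec (cond e (v1, v0) (v0, v1)) (fun c _ q => (N q.1 q.2 (some c), q.1)) p
  let P : X k → V := fun x => (Q0 x.1 x.2).1
  have hPpar : ∀ x, (Q0 x.1 x.2).2 = P (par x) := by
    rintro ⟨e, p⟩
    cases p with
    | nil => cases e <;> rfl
    | cons c p => rfl
  have hPcons : ∀ c x, P (cons c x) = N (P x) (P (par x)) (some c) := by
    intro c x
    rw [← hPpar]
    rfl
  have hadj : ∀ x, G.Adj (P x) (P (par x)) := by
    rintro ⟨e, p⟩
    induction p with
    | nil =>
      cases e
      · exact hv1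
      · exact hv1.symm
    | cons c p ih =>
      have : ((e, c :: p) : X k) = cons c (e, p) := rfl
      rw [this, par_cons, hPcons]
      exact (((hN _ _ ih).2.2 _).2 ⟨_, rfl⟩).symm
  have hnb : ∀ x i, P (nbr x i) = N (P x) (P (par x)) i := by
    intro x i
    cases i with
    | none => exact ((hN _ _ (hadj x)).1).symm
    | some c => exact hPcons c x
  have hinj : ∀ x, Function.Injective (fun i => P (nbr x i)) := by
    intro x i j h
    simp only [hnb] at h
    exact (hN _ _ (hadj x)).2.1 h
  have hnbr : ∀ x w, G.Adj (P x) w ↔ ∃ i, w = P (nbr x i) := by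
    intro x w
    simp only [hnb]
    exact (hN _ _ (hadj x)).2.2 w
  have tree : G.IsTree := ⟨hc, ha⟩
  have hP0 : P (false, []) = v0 := rfl
  have hdist : ∀ x, x ≠ (false, []) → G.dist v0 (P x) = G.dist v0 (P (par x)) + 1 := by
    rintro ⟨e, p⟩
    induction p with
    | nil =>
      cases e
      · intro h; exact absurd rfl h
      · intro _
        change G.dist v0 v1 = G.dist v0 v0 + 1
        rw [SimpleGraph.dist_self, SimpleGraph.dist_eq_one_iff_adj.2 hv1]
    | cons c p ih =>
      intro _
      change _ = G.dist v0 (P (e, p)) + 1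
      rcases tree.dist_eq_dist_add_one_of_adj v0 (hadj (e, c :: p)) with h | h
      · exact h
      · exfalso
        change G.dist v0 (P (e, p)) = _ at h
        by_cases hr : ((e, p) : X k) = (false, [])
        · rw [hr, hP0, SimpleGraph.dist_self] at h
          omega
        · have := closer_unique hc ha (hadj (e, c :: p)) (hadj (e, p)).symm h (ih hr)
          exact par_ne_cons (e, p) c ((nbr_inj (e, p)).eq_iff.2
            (hinj (e, p) (a₁ := some c) (a₂ := none) this)).symm
  have hzero : ∀ x, G.dist v0 (P x) = 0 → x = (false, []) := by
    intro x hx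
    by_contra h
    rw [hdist x h] at hx
    omega
  have hPinj : ∀ n x y, G.dist v0 (P x) = n → P x = P y → x = y := by
    intro n
    induction n with
    | zero =>
      intro x y h he
      rw [hzero x h, hzero y (by rw [← he]; exact h)]
    | succ n ih =>
      intro x y h he
      have hx : x ≠ (false, []) := by
        rintro rfl; rw [hP0, SimpleGraph.dist_self] at h; omega
      have hy : y ≠ (false, []) := by
        rintro rfl; rw [he, hP0, SimpleGraph.dist_self] at h; omega
      have h1 := hdist x hx
      have h2 := hdist y hy
      rw [← he] at h2
      have ax := hadj x
      have ay := hadj y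
      rw [← he] at ay
      have hpp := ih _ _ (by omega) (closer_unique hc ha ax.symm ay.symm h1 h2)
      obtain ⟨i, hi⟩ := madj_iff_nbr.1 (show madj (par x) x from Or.inr rfl)
      obtain ⟨j, hj⟩ := madj_iff_nbr.1 (show madj (par x) y from Or.inr hpp.symm)
      rw [hi, hj]
      congr 1
      apply hinj (par x)
      change P _ = P _
      rw [← hi, ← hj, he]
  have hPsurj : ∀ w, ∃ x, P x = w := by
    intro w
    obtain ⟨p⟩ := hc v0 w
    have : ∀ a b (p : G.Walk a b), (∃ x, P x = a) → ∃ x, P x = b := by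
      intro a b p
      induction p with
      | nil => exact id
      | cons h _ ih =>
        rintro ⟨x, rfl⟩
        obtain ⟨i, hi⟩ := (hnbr x _).1 h
        exact ih ⟨_, hi.symm⟩
    exact this _ _ p ⟨(false, []), hP0⟩
  have hPi : Function.Injective P := fun x y h => hPinj _ x y rfl h
  refine ⟨Equiv.ofBijective P ⟨hPi, hPsurj⟩, fun x y => ?_⟩
  change G.Adj (P x) (P y) ↔ _
  rw [hnbr, madj_iff_nbr]
  exact exists_congr fun i => hPi.eq_iff

end iso
end Mdl

open Mdl in
theorem exists_dense_free_almost_free (G : SimpleGraph V) (d : ℕ) (hd : 3 ≤ d)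
    (hT : IsRegularTree G d) :
    ∃ (m : ℕ) (f : FreeGroup (Fin m) →* ↥(graphAut G)),
      Function.Injective f ∧
      @Dense ↥(graphAut G) (pointwiseTopology G) (f.range : Set ↥(graphAut G)) ∧
      ActsAlmostFreely G f.range := by
  obtain ⟨k, rfl⟩ : ∃ k, d = k + 3 := ⟨d - 3, by omega⟩
  obtain ⟨hc, ha, hdeg⟩ := hT
  obtain ⟨Ψ, hΨ⟩ := exists_iso hc ha hdeg
  obtain ⟨a, ha1, ha2, ha3⟩ := model k
  classical
  let E : J k ≃ Fin (Fintype.card (J k)) := Fintype.equivFin (J k)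
  have hmem : ∀ g : Equiv.Perm (X k), (∀ x y, madj (g x) (g y) ↔ madj x y) →
      Ψ.permCongr g ∈ graphAut G := by
    intro g hg u v
    simp only [Equiv.permCongr_apply]
    rw [hΨ, hg, ← hΨ]
    simp
  let b : Fin (Fintype.card (J k)) → graphAut G := fun i => ⟨Ψ.permCongr (a (E.symm i)), hmem _ (ha1 _)⟩
  let f : FreeGroup (Fin (Fintype.card (J k))) →* graphAut G := FreeGroup.lift b
  let t : FreeGroup (Fin (Fintype.card (J k))) ≃* FreeGroup (J k) :=
    FreeGroup.freeGroupCongr E.symm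
  have hf : ∀ w v, (f w : Equiv.Perm V) v = Ψ (FreeGroup.lift a (t w) (Ψ.symm v)) := by
    have : (graphAut G).subtype.comp f = (Ψ.permCongrHom.toMonoidHom.comp
        (FreeGroup.lift a)).comp t.toMonoidHom := by
      ext i v
      simp [f, b, t]
    intro w v
    have := congrArg (fun h => (h w : Equiv.Perm V) v) this
    exact this
  have hfin : ∀ w, w ≠ 1 → {v : V | (f w : Equiv.Perm V) v = v}.Finite := by
    intro w hw
    have h := ha2 (t w) (by simpa using hw)
    refine (h.image Ψ).subset ?_
    intro v hv
    rw [Set.mem_ofPred_eq, hf] at hv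
    refine ⟨Ψ.symm v, ?_, by simp⟩
    rw [Set.mem_ofPred_eq]
    apply Ψ.injective
    rw [hv]; simp
  haveI : Infinite V := Infinite.of_injective Ψ Ψ.injective
  refine ⟨_, f, ?_, ?_, ?_⟩
  · rw [injective_iff_map_eq_one]
    intro w hw
    by_contra hne
    have := hfin w hne
    rw [hw] at this
    exact Set.infinite_univ (this.subset fun v _ => rfl)
  · letI : TopologicalSpace V := ⊥
    letI : TopologicalSpace (graphAut G) := pointwiseTopology G
    haveI : DiscreteTopology V := ⟨rfl⟩
    intro g
    rw [mem_closure_iff]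
    intro o ho hgo
    obtain ⟨o', ho', rfl⟩ := isOpen_induced_iff.1 ho
    obtain ⟨I, u, hu, hsub⟩ := isOpen_pi_iff.1 ho' _ hgo
    obtain ⟨N, hN⟩ : ∃ N, ∀ v ∈ I, len (Ψ.symm v) ≤ N :=
      ⟨I.sup fun v => len (Ψ.symm v), fun v hv => Finset.le_sup (f := fun v => len (Ψ.symm v)) hv⟩
    obtain ⟨w, hw⟩ := ha3 (Ψ.symm.permCongr (g : Equiv.Perm V)) (by
      intro x y
      simp only [Equiv.permCongr_apply]
      rw [← hΨ]
      simp only [Equiv.symm_symm, Equiv.apply_symm_apply]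
      rw [g.2, hΨ]) N
    refine ⟨f (t.symm w), ?_, ⟨_, rfl⟩⟩
    apply hsub
    intro v hv
    have : (f (t.symm w) : Equiv.Perm V) v = (g : Equiv.Perm V) v := by
      rw [hf]
      simp only [MulEquiv.apply_symm_apply]
      rw [hw _ (hN v hv)]
      simp [Equiv.permCongr_apply]
    change (f (t.symm w) : Equiv.Perm V) v ∈ u v
    rw [this]
    exact (hu v hv).2
  · rintro _ ⟨w, rfl⟩ hne
    exact hfin w (by rintro rfl; exact hne (map_one f))

end TreePaper
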